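/- Fix g > 0. Let U_L, U_R be two states with 𝒫(h_L), 𝒫(h_R) invertible and bottoms B_L, B_R ∈ ℝ^K, and write ā = (a_L + a_R)/2, ⟦a⟧ = a_R − a_L for any quantity a (in particular for u, v, B, V, Ψ, Φ). Then the energy-conservative fluxes satisfy the sufficient energy-conservation conditions: ⟦V⟧·𝓕ᴱᶜ(U_L, U_R) = ⟦Ψ⟧ + g⟦B⟧ᵀ𝒫(h̄)ū and ⟦V⟧·𝓖ᴱᶜ(U_L, U_R) = ⟦Φ⟧ + g⟦B⟧ᵀ𝒫(h̄)v̄. -/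

import Mathlib

open Matrix

/-- The Galerkin triple-product matrix `𝒫(a)`, defined by
`(𝒫(a))_{l,m} = ∑ k, a k * T k l m`. -/
noncomputable def Pmat {K : ℕ} (T : Fin K → Fin K → Fin K → ℝ) (a : Fin K → ℝ) :
    Matrix (Fin K) (Fin K) ℝ :=
  Matrix.of fun l m => ∑ k, a k * T k l m

/-- A state `U = (h, qˣ, qʸ) ∈ ℝ^K × ℝ^K × ℝ^K`. -/
abbrev StateK (K : ℕ) := (Fin K → ℝ) × (Fin K → ℝ) × (Fin K → ℝ)

/-- Velocity coefficients `𝒫(h)⁻¹ q`. -/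
noncomputable def uvel {K : ℕ} (T : Fin K → Fin K → Fin K → ℝ) (h q : Fin K → ℝ) :
    Fin K → ℝ :=
  (Pmat T h)⁻¹ *ᵥ q

/-- The interface average `ā = (a_L + a_R)/2`. -/
noncomputable def avg {K : ℕ} (aL aR : Fin K → ℝ) : Fin K → ℝ :=
  (1 / 2 : ℝ) • (aL + aR)

/-- Dot product on `ℝ^{3K}` realized as triples. -/
noncomputable def tdot {K : ℕ} (a b : StateK K) : ℝ :=
  a.1 ⬝ᵥ b.1 + a.2.1 ⬝ᵥ b.2.1 + a.2.2 ⬝ᵥ b.2.2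

/-- The entropy variable `V(U) = (−½𝒫(u)u − ½𝒫(v)v + g(h+B), u, v)`. -/
noncomputable def Vvar {K : ℕ} (T : Fin K → Fin K → Fin K → ℝ) (g : ℝ)
    (B : Fin K → ℝ) (U : StateK K) : StateK K :=
  (-(1 / 2 : ℝ) • (Pmat T (uvel T U.1 U.2.1) *ᵥ uvel T U.1 U.2.1)
      - (1 / 2 : ℝ) • (Pmat T (uvel T U.1 U.2.2) *ᵥ uvel T U.1 U.2.2)
      + g • (U.1 + B),
   uvel T U.1 U.2.1, uvel T U.1 U.2.2)

/-- The energy potential `Ψ(U) = ½g uᵀ𝒫(h)h`. -/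
noncomputable def Psi {K : ℕ} (T : Fin K → Fin K → Fin K → ℝ) (g : ℝ)
    (U : StateK K) : ℝ :=
  (1 / 2) * g * (uvel T U.1 U.2.1 ⬝ᵥ (Pmat T U.1 *ᵥ U.1))

/-- The energy potential `Φ(U) = ½g vᵀ𝒫(h)h`. -/
noncomputable def Phi {K : ℕ} (T : Fin K → Fin K → Fin K → ℝ) (g : ℝ)
    (U : StateK K) : ℝ :=
  (1 / 2) * g * (uvel T U.1 U.2.2 ⬝ᵥ (Pmat T U.1 *ᵥ U.1))

/-- The energy-conservative numerical flux `𝓕ᴱᶜ(U_L,U_R)`. -/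
noncomputable def FEC {K : ℕ} (T : Fin K → Fin K → Fin K → ℝ) (g : ℝ)
    (UL UR : StateK K) : StateK K :=
  let hb := avg UL.1 UR.1
  let ub := avg (uvel T UL.1 UL.2.1) (uvel T UR.1 UR.2.1)
  let vb := avg (uvel T UL.1 UL.2.2) (uvel T UR.1 UR.2.2)
  let phh := avg (Pmat T UL.1 *ᵥ UL.1) (Pmat T UR.1 *ᵥ UR.1)
  (Pmat T hb *ᵥ ub,
   ((1 / 2) * g) • phh + Pmat T ub *ᵥ (Pmat T hb *ᵥ ub),
   Pmat T vb *ᵥ (Pmat T hb *ᵥ ub))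

/-- The energy-conservative numerical flux `𝓖ᴱᶜ(U_L,U_R)`. -/
noncomputable def GEC {K : ℕ} (T : Fin K → Fin K → Fin K → ℝ) (g : ℝ)
    (UL UR : StateK K) : StateK K :=
  let hb := avg UL.1 UR.1
  let ub := avg (uvel T UL.1 UL.2.1) (uvel T UR.1 UR.2.1)
  let vb := avg (uvel T UL.1 UL.2.2) (uvel T UR.1 UR.2.2)
  let phh := avg (Pmat T UL.1 *ᵥ UL.1) (Pmat T UR.1 *ᵥ UR.1)
  (Pmat T hb *ᵥ vb,
   Pmat T ub *ᵥ (Pmat T hb *ᵥ vb),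
   ((1 / 2) * g) • phh + Pmat T vb *ᵥ (Pmat T hb *ᵥ vb))

section GalerkinProduct

variable {K : ℕ} {T : Fin K → Fin K → Fin K → ℝ}

theorem Pmat_add (a b : Fin K → ℝ) : Pmat T (a + b) = Pmat T a + Pmat T b := by
  ext l m
  simp [Pmat, add_mul, Finset.sum_add_distrib]

theorem Pmat_smul (c : ℝ) (a : Fin K → ℝ) : Pmat T (c • a) = c • Pmat T a := by
  ext l m
  simp [Pmat, mul_assoc, Finset.mul_sum]

theorem Pmat_mulVec_comm (hT1 : ∀ k l m, T k l m = T l k m) (hT2 : ∀ k l m, T k l m = T k m l)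
    (a b : Fin K → ℝ) : Pmat T a *ᵥ b = Pmat T b *ᵥ a := by
  ext l
  simp only [Pmat, mulVec, dotProduct, of_apply, Finset.sum_mul]
  rw [Finset.sum_comm]
  refine Finset.sum_congr rfl fun k _ => Finset.sum_congr rfl fun m _ => ?_
  rw [hT2 k l m, hT1 k m l, hT2 m k l]
  ring

theorem dotProduct_Pmat_mulVec (hT2 : ∀ k l m, T k l m = T k m l) (a x y : Fin K → ℝ) :
    x ⬝ᵥ (Pmat T a *ᵥ y) = (Pmat T a *ᵥ x) ⬝ᵥ y := by
  have h : (Pmat T a)ᵀ = Pmat T a := by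
    ext l m
    simp [Pmat, fun k => hT2 k m l]
  rw [dotProduct_mulVec, ← mulVec_transpose, h]

/-- The jump of `𝒫(a)a` is `2 𝒫(ā)⟦a⟧`. -/
theorem Pmat_avg_mulVec_sub (hT1 : ∀ k l m, T k l m = T l k m)
    (hT2 : ∀ k l m, T k l m = T k m l) (a b : Fin K → ℝ) :
    Pmat T (avg a b) *ᵥ (b - a) = (1 / 2 : ℝ) • (Pmat T b *ᵥ b - Pmat T a *ᵥ a) := by
  rw [avg, Pmat_smul, Pmat_add, smul_mulVec, add_mulVec, mulVec_sub, mulVec_sub,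
    Pmat_mulVec_comm hT1 hT2 a b]
  congr 1
  abel

/-- The discrete energy balance in the direction of the velocity `u`, with transverse
velocity `v`. -/
theorem jump_dotProduct_flux (hT1 : ∀ k l m, T k l m = T l k m)
    (hT2 : ∀ k l m, T k l m = T k m l) (g : ℝ) (hL hR uL uR vL vR BL BR : Fin K → ℝ) :
    (-(1 / 2 : ℝ) • (Pmat T uR *ᵥ uR) - (1 / 2 : ℝ) • (Pmat T vR *ᵥ vR) + g • (hR + BR)
        - (-(1 / 2 : ℝ) • (Pmat T uL *ᵥ uL) - (1 / 2 : ℝ) • (Pmat T vL *ᵥ vL) + g • (hL + BL)))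
          ⬝ᵥ (Pmat T (avg hL hR) *ᵥ avg uL uR)
      + (uR - uL) ⬝ᵥ (((1 / 2) * g) • avg (Pmat T hL *ᵥ hL) (Pmat T hR *ᵥ hR)
          + Pmat T (avg uL uR) *ᵥ (Pmat T (avg hL hR) *ᵥ avg uL uR))
      + (vR - vL) ⬝ᵥ (Pmat T (avg vL vR) *ᵥ (Pmat T (avg hL hR) *ᵥ avg uL uR))
    = (1 / 2) * g * (uR ⬝ᵥ (Pmat T hR *ᵥ hR)) - (1 / 2) * g * (uL ⬝ᵥ (Pmat T hL *ᵥ hL))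
      + g * ((BR - BL) ⬝ᵥ (Pmat T (avg hL hR) *ᵥ avg uL uR)) := by
  have hh : (hR - hL) ⬝ᵥ (Pmat T (avg hL hR) *ᵥ avg uL uR)
      = ((1 / 2 : ℝ) • (Pmat T hR *ᵥ hR - Pmat T hL *ᵥ hL)) ⬝ᵥ avg uL uR := by
    rw [dotProduct_Pmat_mulVec hT2, Pmat_avg_mulVec_sub hT1 hT2]
  rw [dotProduct_add, dotProduct_Pmat_mulVec hT2 (avg uL uR), dotProduct_Pmat_mulVec hT2
    (avg vL vR), Pmat_avg_mulVec_sub hT1 hT2, Pmat_avg_mulVec_sub hT1 hT2]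
  generalize Pmat T (avg hL hR) *ᵥ avg uL uR = w at *
  generalize Pmat T hL *ᵥ hL = pL at *
  generalize Pmat T hR *ᵥ hR = pR at *
  simp only [avg, sub_dotProduct, add_dotProduct, smul_dotProduct, dotProduct_add,
    dotProduct_smul, smul_eq_mul, dotProduct_comm pL, dotProduct_comm pR] at hh ⊢
  linear_combination g * hh

end GalerkinProduct

/-- the energy-conservative fluxes satisfy the sufficient
energy-conservation conditions
`⟦V⟧·𝓕ᴱᶜ = ⟦Ψ⟧ + g⟦B⟧ᵀ𝒫(h̄)ū` and `⟦V⟧·𝓖ᴱᶜ = ⟦Φ⟧ + g⟦B⟧ᵀ𝒫(h̄)v̄`. -/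
theorem ec_fluxes_sufficient_conditions {K : ℕ} (hK : 1 ≤ K)
    (T : Fin K → Fin K → Fin K → ℝ)
    (hT1 : ∀ k l m, T k l m = T l k m) (hT2 : ∀ k l m, T k l m = T k m l)
    (g : ℝ) (hg : 0 < g) (UL UR : StateK K) (BL BR : Fin K → ℝ)
    (invL : IsUnit (Pmat T UL.1)) (invR : IsUnit (Pmat T UR.1)) :
    tdot (Vvar T g BR UR - Vvar T g BL UL) (FEC T g UL UR)
        = Psi T g UR - Psi T g UL
          + g * ((BR - BL) ⬝ᵥ (Pmat T (avg UL.1 UR.1)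
              *ᵥ avg (uvel T UL.1 UL.2.1) (uvel T UR.1 UR.2.1)))
      ∧ tdot (Vvar T g BR UR - Vvar T g BL UL) (GEC T g UL UR)
        = Phi T g UR - Phi T g UL
          + g * ((BR - BL) ⬝ᵥ (Pmat T (avg UL.1 UR.1)
              *ᵥ avg (uvel T UL.1 UL.2.2) (uvel T UR.1 UR.2.2))) := by
  refine ⟨jump_dotProduct_flux hT1 hT2 g _ _ _ _ _ _ _ _, ?_⟩
  have h := jump_dotProduct_flux hT1 hT2 g UL.1 UR.1 (uvel T UL.1 UL.2.2) (uvel T UR.1 UR.2.2)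
    (uvel T UL.1 UL.2.1) (uvel T UR.1 UR.2.1) BL BR
  refine Eq.trans ?_ h
  simp only [tdot, Vvar, GEC, Prod.fst_sub, Prod.snd_sub]
  rw [add_right_comm]
  congr 3
  module
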